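/- (Proposition 2: the Gaussian flow satisfies the governing equation.) Fix κ ≥ 0 and define, for λ ∈ [0,1], the density π_λ(x) = N(x; μ_λ, Σ_λ), the drift f(λ, x) = Σ_λ Hᵀ R⁻¹ ( (y − H μ_λ) − ½ H (x − μ_λ) ) − ½ κ (x − μ_λ), and the (x-independent) matrix Q_λ = ½ κ Σ_λ. Then for every λ ∈ [0,1] and every x ∈ ℝ^d: log N(y; H x, R) − ∫_{ℝ^d} π_λ(x') · log N(y; H x', R) dx' + tr(∂f/∂x (λ, x)) + ⟨∇_x log π_λ(x), f(λ, x)⟩ − tr(Q_λ · ∇²_x log π_λ(x)) − ⟨∇_x log π_λ(x), Q_λ ∇_x log π_λ(x)⟩ = 0. -/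

import Mathlib

open Matrix

/-- The `k`-dimensional Gaussian density with mean `μ` and covariance `S`. -/
noncomputable def gaussDensity {k : ℕ} (μ : Fin k → ℝ) (S : Matrix (Fin k) (Fin k) ℝ)
    (x : Fin k → ℝ) : ℝ :=
  ((2 * Real.pi) ^ k * S.det) ^ (-(1 : ℝ) / 2) *
    Real.exp (-(1 / 2) * ((x - μ) ⬝ᵥ (S⁻¹ *ᵥ (x - μ))))

/-- Partial derivative in the `i`-th coordinate direction of a function on `ℝ^d`. -/
noncomputable def pdv {d : ℕ} (F : (Fin d → ℝ) → ℝ) (x : Fin d → ℝ) (i : Fin d) : ℝ :=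
  fderiv ℝ F x (Pi.single i 1)

section

open MeasureTheory ProbabilityTheory
open scoped MatrixOrder

theorem exists_eq_mul_transpose_of_posDef {d : ℕ} {S : Matrix (Fin d) (Fin d) ℝ} (hS : S.PosDef) :
    ∃ A : Matrix (Fin d) (Fin d) ℝ, S = A * Aᵀ ∧ A.det ≠ 0 := by
  obtain ⟨B, hB⟩ := CStarAlgebra.nonneg_iff_eq_star_mul_self.mp hS.posSemidef.nonneg
  rw [star_eq_conjTranspose, conjTranspose_eq_transpose_of_trivial] at hB
  refine ⟨Bᵀ, by simpa using hB, fun h => hS.det_pos.ne' ?_⟩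
  rw [hB, det_mul, h, zero_mul]

theorem integrable_gaussianPDFReal_mul_pow (n : ℕ) :
    Integrable fun t : ℝ => gaussianPDFReal 0 1 t * t ^ n := by
  have h := (integrable_rpow_mul_exp_neg_mul_sq (b := 1 / 2) (by norm_num) (s := n)
    (by linarith [n.cast_nonneg (α := ℝ)])).const_mul (√(2 * Real.pi))⁻¹
  refine h.congr (.of_forall fun t => ?_)
  simp only [gaussianPDFReal_def, Real.rpow_natCast, NNReal.coe_one, mul_one, sub_zero]
  rw [show -(1 / 2) * t ^ 2 = -t ^ 2 / 2 by ring]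
  ring

theorem integral_gaussianPDFReal_mul_id : ∫ t : ℝ, gaussianPDFReal 0 1 t * t = 0 := by
  have h := integral_gaussianReal_eq_integral_smul (μ := 0) (v := 1) (f := fun t : ℝ => t)
    one_ne_zero
  rw [integral_id_gaussianReal] at h
  simpa using h.symm

theorem integral_gaussianPDFReal_mul_sq : ∫ t : ℝ, gaussianPDFReal 0 1 t * t ^ 2 = 1 := by
  have h := integral_gaussianReal_eq_integral_smul (μ := 0) (v := 1) (f := fun t : ℝ => t ^ 2)
    one_ne_zero
  have hv := variance_fun_id_gaussianReal (μ := 0) (v := 1)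
  rw [variance_eq_integral (by fun_prop)] at hv
  simp only [integral_id_gaussianReal, sub_zero, NNReal.coe_one] at hv
  rw [hv] at h
  simpa using h.symm

theorem integrable_prod_gaussianPDFReal_mul_prod_pow {d : ℕ} (e : Fin d → ℕ) :
    Integrable fun z : Fin d → ℝ => (∏ k, gaussianPDFReal 0 1 (z k)) * ∏ k, z k ^ e k := by
  simp_rw [← Finset.prod_mul_distrib]
  exact Integrable.fintype_prod (f := fun k t => gaussianPDFReal 0 1 t * t ^ e k)
    fun k => integrable_gaussianPDFReal_mul_pow (e k)

theorem integral_prod_gaussianPDFReal_mul_prod_pow {d : ℕ} (e : Fin d → ℕ) :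
    ∫ z : Fin d → ℝ, (∏ k, gaussianPDFReal 0 1 (z k)) * ∏ k, z k ^ e k =
      ∏ k, ∫ t, gaussianPDFReal 0 1 t * t ^ e k := by
  simp_rw [← Finset.prod_mul_distrib]
  exact integral_fintype_prod_volume_eq_prod fun k t => gaussianPDFReal 0 1 t * t ^ e k

theorem prod_pow_single {d : ℕ} (z : Fin d → ℝ) (i : Fin d) :
    ∏ k, z k ^ (Pi.single i 1 : Fin d → ℕ) k = z i := by
  rw [Finset.prod_eq_single i] <;> simp +contextual

theorem prod_pow_single_add_single {d : ℕ} (z : Fin d → ℝ) (i j : Fin d) :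
    ∏ k, z k ^ (Pi.single i 1 + Pi.single j 1 : Fin d → ℕ) k = z i * z j := by
  simp_rw [Pi.add_apply, pow_add, Finset.prod_mul_distrib, prod_pow_single]

theorem integral_prod_gaussianPDFReal {d : ℕ} :
    ∫ z : Fin d → ℝ, ∏ k, gaussianPDFReal 0 1 (z k) = 1 := by
  rw [integral_fintype_prod_volume_eq_prod fun _ => gaussianPDFReal 0 1]
  simp [integral_gaussianPDFReal_eq_one]

theorem integral_prod_gaussianPDFReal_mul_apply {d : ℕ} (i : Fin d) :
    ∫ z : Fin d → ℝ, (∏ k, gaussianPDFReal 0 1 (z k)) * z i = 0 := by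
  have h := integral_prod_gaussianPDFReal_mul_prod_pow (Pi.single i 1)
  simp_rw [prod_pow_single] at h
  rw [h]
  exact Finset.prod_eq_zero (Finset.mem_univ i) (by simp [integral_gaussianPDFReal_mul_id])

theorem integral_prod_gaussianPDFReal_mul_apply_mul_apply {d : ℕ} (i j : Fin d) :
    ∫ z : Fin d → ℝ, (∏ k, gaussianPDFReal 0 1 (z k)) * (z i * z j) = if i = j then 1 else 0 := by
  have h := integral_prod_gaussianPDFReal_mul_prod_pow (Pi.single i 1 + Pi.single j 1)
  simp_rw [prod_pow_single_add_single] at h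
  rw [h]
  split_ifs with hij
  · subst hij
    refine Finset.prod_eq_one fun k _ => ?_
    by_cases hk : k = i
    · subst hk
      simp [integral_gaussianPDFReal_mul_sq]
    · simp [hk, integral_gaussianPDFReal_eq_one]
  · exact Finset.prod_eq_zero (Finset.mem_univ i) (by simp [hij, integral_gaussianPDFReal_mul_id])

theorem integral_prod_gaussianPDFReal_mul_quadratic {d : ℕ} (a : ℝ) (b : Fin d → ℝ)
    (C : Matrix (Fin d) (Fin d) ℝ) :
    ∫ z : Fin d → ℝ, (∏ k, gaussianPDFReal 0 1 (z k)) * (a + z ⬝ᵥ b + z ⬝ᵥ (C *ᵥ z)) =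
      a + C.trace := by
  have h0 : Integrable fun z : Fin d → ℝ => ∏ k, gaussianPDFReal 0 1 (z k) := by
    simpa using integrable_prod_gaussianPDFReal_mul_prod_pow (0 : Fin d → ℕ)
  have h1 (i : Fin d) :
      Integrable fun z : Fin d → ℝ => (∏ k, gaussianPDFReal 0 1 (z k)) * z i := by
    simpa only [prod_pow_single] using
      integrable_prod_gaussianPDFReal_mul_prod_pow (Pi.single i 1)
  have h2 (i j : Fin d) :
      Integrable fun z : Fin d → ℝ => (∏ k, gaussianPDFReal 0 1 (z k)) * (z i * z j) := by
    have h := integrable_prod_gaussianPDFReal_mul_prod_pow (Pi.single i 1 + Pi.single j 1)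
    simp_rw [prod_pow_single_add_single] at h
    exact h
  have hexp (z : Fin d → ℝ) :
      (∏ k, gaussianPDFReal 0 1 (z k)) * (a + z ⬝ᵥ b + z ⬝ᵥ (C *ᵥ z)) =
        (∏ k, gaussianPDFReal 0 1 (z k)) * a +
          ∑ i, ((∏ k, gaussianPDFReal 0 1 (z k)) * z i) * b i +
          ∑ i, ∑ j, ((∏ k, gaussianPDFReal 0 1 (z k)) * (z i * z j)) * C i j := by
    simp only [dotProduct, mulVec, mul_add, Finset.mul_sum]
    congr 2
    · exact Finset.sum_congr rfl fun i _ => by ring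
    · exact funext fun i => Finset.sum_congr rfl fun j _ => by ring
  have i1 (i : Fin d) := (h1 i).mul_const (b i)
  have i2 (i j : Fin d) := (h2 i j).mul_const (C i j)
  have s1 := integrable_finsetSum Finset.univ fun i _ => i1 i
  have s2' (i : Fin d) := integrable_finsetSum Finset.univ fun j _ => i2 i j
  have s2 := integrable_finsetSum Finset.univ fun i _ => s2' i
  have s01 : Integrable fun z : Fin d → ℝ => (∏ k, gaussianPDFReal 0 1 (z k)) * a +
      ∑ i, ((∏ k, gaussianPDFReal 0 1 (z k)) * z i) * b i := (h0.mul_const a).add s1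
  rw [integral_congr_ae (.of_forall hexp), integral_add s01 s2, integral_add (h0.mul_const a) s1,
    integral_finsetSum _ fun i _ => i1 i, integral_finsetSum _ fun i _ => s2' i]
  simp_rw [integral_finsetSum _ fun j _ => i2 _ j, integral_mul_const,
    integral_prod_gaussianPDFReal, integral_prod_gaussianPDFReal_mul_apply,
    integral_prod_gaussianPDFReal_mul_apply_mul_apply]
  simp [trace]

theorem gaussDensity_add_mulVec {d : ℕ} (μ : Fin d → ℝ) {A : Matrix (Fin d) (Fin d) ℝ}
    (hA : A.det ≠ 0) (z : Fin d → ℝ) :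
    gaussDensity μ (A * Aᵀ) (A *ᵥ z + μ) = |A.det|⁻¹ * ∏ k, gaussianPDFReal 0 1 (z k) := by
  have hq : (A *ᵥ z) ⬝ᵥ ((A * Aᵀ)⁻¹ *ᵥ (A *ᵥ z)) = ∑ k, z k ^ 2 := by
    have hu : IsUnit A.det := hA.isUnit
    have hut : IsUnit Aᵀ.det := by rwa [det_transpose]
    rw [Matrix.mul_inv_rev, mulVec_mulVec, Matrix.mul_assoc, nonsing_inv_mul _ hu, Matrix.mul_one,
      dotProduct_comm, dotProduct_mulVec, ← mulVec_transpose, mulVec_mulVec, mul_nonsing_inv _ hut,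
      one_mulVec]
    simp [dotProduct, sq]
  have hc : ((2 * Real.pi) ^ d * (A * Aᵀ).det) ^ (-(1 : ℝ) / 2) =
      |A.det|⁻¹ * (√(2 * Real.pi))⁻¹ ^ d := by
    have hp : 0 ≤ 2 * Real.pi := by positivity
    rw [det_mul, det_transpose, neg_div,
      Real.rpow_neg (mul_nonneg (pow_nonneg hp _) (mul_self_nonneg _)), ← Real.sqrt_eq_rpow,
      Real.sqrt_mul (pow_nonneg hp _), Real.sqrt_mul_self_eq_abs, Real.sqrt_eq_rpow,
      ← Real.rpow_natCast_mul hp, mul_comm (d : ℝ), Real.rpow_mul_natCast hp, ← Real.sqrt_eq_rpow,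
      mul_inv, inv_pow, mul_comm]
  rw [gaussDensity, add_sub_cancel_right, hq, hc]
  simp only [gaussianPDFReal_def, Finset.prod_mul_distrib, ← Real.exp_sum, NNReal.coe_one, mul_one,
    sub_zero, Finset.prod_const, Finset.card_univ, Fintype.card_fin, ← Finset.sum_div,
    Finset.sum_neg_distrib, mul_assoc]
  congr 3
  ring_nf

theorem integral_gaussDensity_mul {d : ℕ} (μ : Fin d → ℝ) {A : Matrix (Fin d) (Fin d) ℝ}
    (hA : A.det ≠ 0) (F : (Fin d → ℝ) → ℝ) :
    ∫ x, gaussDensity μ (A * Aᵀ) x * F x =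
      ∫ z : Fin d → ℝ, (∏ k, gaussianPDFReal 0 1 (z k)) * F (A *ᵥ z + μ) := by
  have hdet : |A.det| ≠ 0 := abs_ne_zero.mpr hA
  let L : (Fin d → ℝ) ≃L[ℝ] (Fin d → ℝ) :=
    (LinearMap.equivOfDetNeZero (toLin' A) (by rwa [LinearMap.det_toLin'])).toContinuousLinearEquiv
  have hme : MeasurableEmbedding (toLin' A) := L.toHomeomorph.measurableEmbedding
  have hmap := hme.integral_map (μ := volume)
    fun x => gaussDensity μ (A * Aᵀ) (x + μ) * F (x + μ)
  rw [Real.map_matrix_volume_pi_eq_smul_volume_pi hA, integral_smul_measure,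
    integral_add_right_eq_self (fun x => gaussDensity μ (A * Aᵀ) x * F x) μ,
    ENNReal.toReal_ofReal (abs_nonneg _), abs_inv, smul_eq_mul] at hmap
  simp_rw [toLin'_apply, gaussDensity_add_mulVec μ hA, mul_assoc, integral_const_mul] at hmap
  exact mul_left_cancel₀ (inv_ne_zero hdet) hmap

theorem log_gaussDensity {k : ℕ} (μ : Fin k → ℝ) {S : Matrix (Fin k) (Fin k) ℝ} (hS : S.PosDef)
    (x : Fin k → ℝ) :
    Real.log (gaussDensity μ S x) =
      Real.log (((2 * Real.pi) ^ k * S.det) ^ (-(1 : ℝ) / 2)) -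
        (1 / 2) * ((x - μ) ⬝ᵥ (S⁻¹ *ᵥ (x - μ))) := by
  have h : 0 < (2 * Real.pi) ^ k * S.det := mul_pos (by positivity) hS.det_pos
  rw [gaussDensity, Real.log_mul (Real.rpow_pos_of_pos h _).ne' (Real.exp_ne_zero _), Real.log_exp]
  ring

theorem pdv_eq_of_line {d : ℕ} {F : (Fin d → ℝ) → ℝ} {x : Fin d → ℝ} {i : Fin d} {b c : ℝ}
    (hF : DifferentiableAt ℝ F x)
    (h : ∀ t : ℝ, F (x + t • Pi.single i 1) = F x + t * b + t ^ 2 * c) : pdv F x i = b := by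
  rw [pdv, ← hF.lineDeriv_eq_fderiv, lineDeriv]
  simp_rw [h]
  have := (((hasDerivAt_id (0 : ℝ)).mul_const b).const_add (F x)).add
    (((hasDerivAt_id (0 : ℝ)).pow 2).mul_const c)
  simpa [Pi.add_def] using this.deriv

theorem sub_mulVec_quadratic {d m : ℕ} {K : Matrix (Fin m) (Fin m) ℝ} (hK : Kᵀ = K)
    (H : Matrix (Fin m) (Fin d) ℝ) (w : Fin m → ℝ) (v : Fin d → ℝ) :
    (w - H *ᵥ v) ⬝ᵥ (K *ᵥ (w - H *ᵥ v)) =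
      w ⬝ᵥ (K *ᵥ w) - 2 * (v ⬝ᵥ ((Hᵀ * K) *ᵥ w)) + v ⬝ᵥ ((Hᵀ * K * H) *ᵥ v) := by
  have h1 : (H *ᵥ v) ⬝ᵥ (K *ᵥ w) = v ⬝ᵥ ((Hᵀ * K) *ᵥ w) := by
    rw [← mulVec_mulVec, dotProduct_mulVec v, vecMul_transpose]
  have h2 : w ⬝ᵥ (K *ᵥ (H *ᵥ v)) = v ⬝ᵥ ((Hᵀ * K) *ᵥ w) := by
    rw [← h1, dotProduct_mulVec, ← mulVec_transpose, hK, dotProduct_comm]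
  have h3 : (H *ᵥ v) ⬝ᵥ (K *ᵥ (H *ᵥ v)) = v ⬝ᵥ ((Hᵀ * K * H) *ᵥ v) := by
    rw [← mulVec_mulVec v, ← mulVec_mulVec, dotProduct_mulVec v, vecMul_transpose]
  rw [mulVec_sub, sub_dotProduct, dotProduct_sub, dotProduct_sub, h1, h2, h3]
  ring

theorem integral_gaussDensity_mul_log_gaussDensity {d m : ℕ} (μ : Fin d → ℝ)
    {S : Matrix (Fin d) (Fin d) ℝ} (hS : S.PosDef) (H : Matrix (Fin m) (Fin d) ℝ)
    {R : Matrix (Fin m) (Fin m) ℝ} (hR : R.PosDef) (y : Fin m → ℝ) :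
    ∫ x, gaussDensity μ S x * Real.log (gaussDensity (H *ᵥ x) R y) =
      Real.log (gaussDensity (H *ᵥ μ) R y) - (1 / 2) * ((Hᵀ * R⁻¹ * H) * S).trace := by
  obtain ⟨A, rfl, hA⟩ := exists_eq_mul_transpose_of_posDef hS
  have hK : R⁻¹ᵀ = R⁻¹ := by simpa using hR.inv.isHermitian.eq
  set w := y - H *ᵥ μ with hw
  have hexp (z : Fin d → ℝ) : Real.log (gaussDensity (H *ᵥ (A *ᵥ z + μ)) R y) =
      Real.log (gaussDensity (H *ᵥ μ) R y) + z ⬝ᵥ (Aᵀ *ᵥ ((Hᵀ * R⁻¹) *ᵥ w)) +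
        z ⬝ᵥ ((-(1 / 2 : ℝ) • (Aᵀ * (Hᵀ * R⁻¹ * H) * A)) *ᵥ z) := by
    have e : y - H *ᵥ (A *ᵥ z + μ) = w - H *ᵥ (A *ᵥ z) := by
      rw [mulVec_add, hw]; abel
    have e1 : z ⬝ᵥ (Aᵀ *ᵥ ((Hᵀ * R⁻¹) *ᵥ w)) = (A *ᵥ z) ⬝ᵥ ((Hᵀ * R⁻¹) *ᵥ w) := by
      rw [dotProduct_mulVec, vecMul_transpose]
    have e2 : z ⬝ᵥ ((Aᵀ * (Hᵀ * R⁻¹ * H) * A) *ᵥ z) =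
        (A *ᵥ z) ⬝ᵥ ((Hᵀ * R⁻¹ * H) *ᵥ (A *ᵥ z)) := by
      rw [← mulVec_mulVec z, ← mulVec_mulVec, dotProduct_mulVec z, vecMul_transpose]
    rw [log_gaussDensity _ hR, log_gaussDensity _ hR, e, ← hw, sub_mulVec_quadratic hK, e1,
      smul_mulVec, dotProduct_smul, e2, smul_eq_mul]
    ring
  rw [integral_gaussDensity_mul μ hA]
  simp_rw [hexp]
  rw [integral_prod_gaussianPDFReal_mul_quadratic, trace_smul, Matrix.mul_assoc, trace_mul_comm,
    smul_eq_mul, Matrix.mul_assoc _ A]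
  ring

theorem pdv_log_gaussDensity {d : ℕ} (μ : Fin d → ℝ) {S : Matrix (Fin d) (Fin d) ℝ}
    (hS : S.PosDef) (x : Fin d → ℝ) (i : Fin d) :
    pdv (fun x' => Real.log (gaussDensity μ S x')) x i = -(S⁻¹ *ᵥ (x - μ)) i := by
  have hK : S⁻¹ᵀ = S⁻¹ := by simpa using hS.inv.isHermitian.eq
  simp_rw [log_gaussDensity μ hS]
  refine pdv_eq_of_line (c := -(1 / 2) * S⁻¹ i i) ?_ fun t => ?_
  · simp only [dotProduct, mulVec, Pi.sub_apply]
    fun_prop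
  · have e : x + t • Pi.single i 1 - μ = (x - μ) + t • Pi.single i 1 := by abel
    have h1 : (x - μ) ⬝ᵥ (S⁻¹ *ᵥ Pi.single i 1) = (S⁻¹ *ᵥ (x - μ)) i := by
      rw [dotProduct_mulVec, ← mulVec_transpose, hK, dotProduct_single, mul_one]
    rw [e, mulVec_add, add_dotProduct, dotProduct_add, dotProduct_add, mulVec_smul,
      dotProduct_smul, smul_dotProduct, smul_dotProduct, dotProduct_smul, h1, single_dotProduct,
      single_dotProduct]
    simp
    ring

theorem pdv_mulVec_affine {d : ℕ} (M : Matrix (Fin d) (Fin d) ℝ) (a μ x : Fin d → ℝ) (i j : Fin d) :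
    pdv (fun x' => (a + M *ᵥ (x' - μ)) i) x j = M i j := by
  refine pdv_eq_of_line (c := 0) ?_ fun t => ?_
  · simp only [dotProduct, mulVec, Pi.sub_apply, Pi.add_apply]
    fun_prop
  · have e : x + t • Pi.single j 1 - μ = (x - μ) + t • Pi.single j 1 := by abel
    rw [e, mulVec_add, mulVec_smul]
    simp
    ring

end

/-- Proposition 2: the Gaussian flow with drift
`f(λ,x) = Σ_λ Hᵀ R⁻¹ ((y - H μ_λ) - ½ H (x - μ_λ)) - ½ κ (x - μ_λ)` and diffusion matrix
`Q_λ = ½ κ Σ_λ` satisfies the governing equation of the exact particle flow for the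
Gaussian bridge `π_λ = N(·; μ_λ, Σ_λ)`. -/
theorem stmt7 {d m : ℕ} (hd : 1 ≤ d) (hm : 1 ≤ m)
    (μ₀ : Fin d → ℝ) (Sig0 : Matrix (Fin d) (Fin d) ℝ) (hSig0 : Sig0.PosDef)
    (H : Matrix (Fin m) (Fin d) ℝ)
    (R : Matrix (Fin m) (Fin m) ℝ) (hR : R.PosDef)
    (y : Fin m → ℝ)
    (κ : ℝ) (hκ : 0 ≤ κ)
    -- the bridge covariance Σ_λ and mean μ_λ
    (Sig : ℝ → Matrix (Fin d) (Fin d) ℝ)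
    (hSig : ∀ l : ℝ, Sig l = (Sig0⁻¹ + l • (Hᵀ * R⁻¹ * H))⁻¹)
    (μ : ℝ → (Fin d → ℝ))
    (hμ : ∀ l : ℝ, μ l = Sig l *ᵥ (Sig0⁻¹ *ᵥ μ₀ + l • ((Hᵀ * R⁻¹) *ᵥ y)))
    -- the bridging density π_λ(x) = N(x; μ_λ, Σ_λ)
    (pi' : ℝ → (Fin d → ℝ) → ℝ)
    (hpi : ∀ l x, pi' l x = gaussDensity (μ l) (Sig l) x)
    -- the drift f(λ, x)
    (f : ℝ → (Fin d → ℝ) → (Fin d → ℝ))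
    (hf : ∀ l x, f l x =
      Sig l *ᵥ ((Hᵀ * R⁻¹) *ᵥ ((y - H *ᵥ μ l) - (1 / 2 : ℝ) • (H *ᵥ (x - μ l)))) -
        (κ / 2) • (x - μ l))
    -- the (x-independent) diffusion matrix Q_λ
    (Q : ℝ → Matrix (Fin d) (Fin d) ℝ)
    (hQ : ∀ l : ℝ, Q l = (κ / 2) • Sig l)
    (l : ℝ) (hl : l ∈ Set.Icc (0 : ℝ) 1) (x : Fin d → ℝ) :
    Real.log (gaussDensity (H *ᵥ x) R y) -
        (∫ x' : Fin d → ℝ, pi' l x' * Real.log (gaussDensity (H *ᵥ x') R y)) +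
      (∑ i, pdv (fun x' => f l x' i) x i) +
      (∑ i, pdv (fun x' => Real.log (pi' l x')) x i * f l x i) -
      (∑ i, ∑ j, Q l i j *
        pdv (fun x' => pdv (fun x'' => Real.log (pi' l x'')) x' i) x j) -
      (∑ i, ∑ j, pdv (fun x' => Real.log (pi' l x')) x i * Q l i j *
        pdv (fun x' => Real.log (pi' l x')) x j) = 0 := by
  obtain rfl : pi' = fun l x => gaussDensity (μ l) (Sig l) x := funext₂ hpi
  have hK : R⁻¹ᵀ = R⁻¹ := by simpa using hR.inv.isHermitian.eq
  have hS : (Sig l).PosDef := by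
    have hG := (hR.inv.posSemidef.conjTranspose_mul_mul_same H).smul hl.1
    rw [conjTranspose_eq_transpose_of_trivial] at hG
    rw [hSig]
    exact (hSig0.inv.add_posSemidef hG).inv
  have hu : IsUnit (Sig l).det := hS.det_pos.ne'.isUnit
  set P := (Sig l)⁻¹ with hP
  have hPt : Pᵀ = P := by simpa using hS.inv.isHermitian.eq
  set v := x - μ l with hv
  set w := y - H *ᵥ μ l with hw
  set g := (Hᵀ * R⁻¹) *ᵥ w with hg
  set G := Hᵀ * R⁻¹ * H with hG
  have hlik : Real.log (gaussDensity (H *ᵥ x) R y) =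
      Real.log (gaussDensity (H *ᵥ μ l) R y) + v ⬝ᵥ g - (1 / 2) * (v ⬝ᵥ (G *ᵥ v)) := by
    have e : y - H *ᵥ x = w - H *ᵥ v := by
      rw [hv, mulVec_sub, hw]; abel
    rw [log_gaussDensity _ hR, log_gaussDensity _ hR, e, ← hw, sub_mulVec_quadratic hK]
    ring
  have hfa (x' : Fin d → ℝ) : f l x' =
      Sig l *ᵥ g + (-(1 / 2 : ℝ) • (Sig l * G) - (κ / 2) • 1) *ᵥ (x' - μ l) := by
    rw [hf, ← hw, mulVec_sub (Hᵀ * R⁻¹), ← hg, mulVec_smul, mulVec_mulVec, ← hG, mulVec_sub,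
      mulVec_smul, mulVec_mulVec _ _ G, sub_mulVec, smul_mulVec, smul_mulVec, one_mulVec, neg_smul]
    abel
  have hdiv : ∑ i, pdv (fun x' => f l x' i) x i =
      -(1 / 2) * (G * Sig l).trace - κ / 2 * d := by
    simp_rw [hfa, pdv_mulVec_affine]
    change trace (-(1 / 2 : ℝ) • (Sig l * G) - (κ / 2) • (1 : Matrix (Fin d) (Fin d) ℝ)) = _
    rw [trace_sub, trace_smul, trace_smul, trace_one, trace_mul_comm, Fintype.card_fin,
      smul_eq_mul, smul_eq_mul]
  have hgrad (x' : Fin d → ℝ) (i : Fin d) :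
      pdv (fun x'' => Real.log (gaussDensity (μ l) (Sig l) x'')) x' i = (-P *ᵥ (x' - μ l)) i := by
    rw [pdv_log_gaussDensity _ hS, neg_mulVec, Pi.neg_apply]
  have hess (i j : Fin d) : pdv (fun x' => (-P *ᵥ (x' - μ l)) i) x j = -P i j := by
    simpa using pdv_mulVec_affine (-P) 0 (μ l) x i j
  have hPS (u : Fin d → ℝ) : (P *ᵥ v) ⬝ᵥ (Sig l *ᵥ u) = v ⬝ᵥ u := by
    rw [dotProduct_mulVec, ← hPt, mulVec_transpose, vecMul_vecMul, nonsing_inv_mul _ hu,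
      vecMul_one]
  have hinner : ∑ i, (-P *ᵥ v) i * f l x i =
      -(v ⬝ᵥ g) + (1 / 2) * (v ⬝ᵥ (G *ᵥ v)) + κ / 2 * (v ⬝ᵥ (P *ᵥ v)) := by
    change (-P *ᵥ v) ⬝ᵥ f l x = _
    rw [hfa, ← hv, sub_mulVec, smul_mulVec, smul_mulVec, one_mulVec, ← mulVec_mulVec, neg_mulVec,
      neg_dotProduct, dotProduct_add, dotProduct_sub, dotProduct_smul, dotProduct_smul, hPS, hPS,
      dotProduct_comm _ v, smul_eq_mul, smul_eq_mul]
    ring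
  have htr : ∑ i, ∑ j, Q l i j * -P i j = -(κ / 2 * d) := by
    have h : (Q l * Pᵀ).trace = κ / 2 * d := by
      rw [hPt, hQ, smul_mul, mul_nonsing_inv _ hu, trace_smul, trace_one, Fintype.card_fin,
        smul_eq_mul]
    rw [← h]
    simp [trace, mul_apply]
  have hquad : ∑ i, ∑ j, (-P *ᵥ v) i * Q l i j * (-P *ᵥ v) j = κ / 2 * (v ⬝ᵥ (P *ᵥ v)) := by
    have h : (-P *ᵥ v) ⬝ᵥ (Q l *ᵥ (-P *ᵥ v)) = κ / 2 * (v ⬝ᵥ (P *ᵥ v)) := by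
      rw [hQ, smul_mulVec, dotProduct_smul, neg_mulVec, neg_dotProduct, hPS, dotProduct_neg,
        neg_neg, smul_eq_mul]
    rw [← h]
    simp only [dotProduct, mulVec, Finset.mul_sum, mul_assoc]
  simp_rw [hgrad, hess, ← hv]
  rw [integral_gaussDensity_mul_log_gaussDensity _ hS _ hR, hlik, hdiv, hinner, htr, hquad]
  ring
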